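/- (Appell's Comparison Theorem, complex version.) Suppose (α_n)_{n≥0} is a sequence of complex numbers such that α_∞ := lim_{n→∞} α_n exists, and let F(x) = Σ_{n≥0} α_n x^n (which converges for real 0 ≤ x < 1). Then lim_{x→1⁻} (1 − x) F(x) = α_∞, where the limit is taken over real x approaching 1 from below. -/

import Mathlib

open Filter Complex

/-- The backward differences of a sequence, starting from `α 0`. -/
def backwardDiff (α : ℕ → ℂ) : ℕ → ℂ
  | 0 => α 0
  | n + 1 => α (n + 1) - α n

theorem sum_range_succ_backwardDiff (α : ℕ → ℂ) (n : ℕ) :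
    ∑ i ∈ Finset.range (n + 1), backwardDiff α i = α n := by
  induction n with
  | zero => simp [backwardDiff]
  | succ n ih => rw [Finset.sum_range_succ, ih, backwardDiff]; ring

theorem summable_mul_pow_of_tendsto {α : ℕ → ℂ} {a : ℂ} (hα : Tendsto α atTop (nhds a))
    {z : ℂ} (hz : ‖z‖ < 1) : Summable fun n => α n * z ^ n := by
  refine summable_of_isBigO_nat (summable_geometric_of_lt_one (norm_nonneg z) hz) ?_
  have h := hα.isBigO_one ℝ |>.mul
    (Asymptotics.isBigO_refl (fun n : ℕ => z ^ n) atTop).norm_right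
  simpa using h

theorem tsum_backwardDiff_mul_pow {α : ℕ → ℂ} {z : ℂ} (h : Summable fun n => α n * z ^ n) :
    ∑' n, backwardDiff α n * z ^ n = (1 - z) * ∑' n, α n * z ^ n := by
  have hshift : Summable fun n => α (n + 1) * z ^ (n + 1) :=
    (summable_nat_add_iff (f := fun n => α n * z ^ n) 1).2 h
  have heq : ∀ n, backwardDiff α (n + 1) * z ^ (n + 1) =
      α (n + 1) * z ^ (n + 1) - z * (α n * z ^ n) := by
    intro n
    rw [backwardDiff]
    ring
  have hdiff : Summable fun n => backwardDiff α (n + 1) * z ^ (n + 1) :=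
    (hshift.sub (h.mul_left z)).congr fun n => (heq n).symm
  have hsummable : Summable fun n => backwardDiff α n * z ^ n :=
    (summable_nat_add_iff (f := fun n => backwardDiff α n * z ^ n) 1).1 hdiff
  have htail : ∑' n, backwardDiff α (n + 1) * z ^ (n + 1) =
      ∑' n, α (n + 1) * z ^ (n + 1) - z * ∑' n, α n * z ^ n := by
    rw [tsum_congr heq, hshift.tsum_sub (h.mul_left z), tsum_mul_left]
  have hzero : backwardDiff α 0 = α 0 := rfl
  have hsplit := h.tsum_eq_zero_add
  rw [hsummable.tsum_eq_zero_add, htail, hzero]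
  linear_combination -hsplit

/-- Appell's Comparison Theorem (complex version): if `α_n → α_∞`, then
`(1 - x) ∑_{n≥0} α_n x^n → α_∞` as real `x → 1⁻`. -/
theorem appell_comparison
    (α : ℕ → ℂ) (αinf : ℂ) (hα : Tendsto α atTop (nhds αinf)) :
    Tendsto (fun x : ℝ => (1 - (x : ℂ)) * ∑' n : ℕ, α n * (x : ℂ) ^ n)
      (nhdsWithin 1 (Set.Iio 1)) (nhds αinf) := by
  have hsum : Tendsto (fun n => ∑ i ∈ Finset.range n, backwardDiff α i) atTop (nhds αinf) := by
    rw [← tendsto_add_atTop_iff_nat 1]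
    simpa only [sum_range_succ_backwardDiff] using hα
  refine (tendsto_map'_iff.1 (tendsto_tsum_powerSeries_nhdsWithin_lt hsum)).congr' ?_
  filter_upwards [Ioo_mem_nhdsLT (zero_lt_one' ℝ)] with x hx
  refine tsum_backwardDiff_mul_pow (summable_mul_pow_of_tendsto hα ?_)
  rw [norm_real, Real.norm_of_nonneg hx.1.le]
  exact hx.2
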